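/- arXiv:1710.11484 — 2 statements merged into one kernel-verified Lean document; each statement's English description precedes it below -/
import Mathlib

section
/- Let p be a prime and let α_p := ∑' (n : ℕ), (p : ℤ_p)^(v_p(n!)) in ℤ_p. Then the p-adic digit expansion of α_p is not eventually periodic: there do not exist T ≥ 1 and N such that d_{i+T}(α_p) = d_i(α_p) for all i ≥ N, where d_i(x) denotes the i-th p-adic digit of x ∈ ℤ_p. -/
open Nat

/-- Position of the `m`-th nonzero digit. -/
def posA (p m : ℕ) : ℕ := padicValNat p (m !) + m + 1

/-- Partial sums. -/
def parS (p M : ℕ) : ℕ := ∑ m ∈ Finset.range M, p ^ posA p m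

theorem val_fact_mono (p : ℕ) [Fact p.Prime] {m n : ℕ} (h : m ≤ n) :
    padicValNat p (m !) ≤ padicValNat p (n !) := by
  rw [← padicValNat_dvd_iff_le (factorial_ne_zero n)]
  exact pow_padicValNat_dvd.trans (factorial_dvd_factorial h)

theorem posA_succ (p : ℕ) [Fact p.Prime] (m : ℕ) :
    posA p (m + 1) = posA p m + padicValNat p (m + 1) + 1 := by
  unfold posA
  rw [factorial_succ, padicValNat.mul (by omega) (factorial_ne_zero m)]
  omega

theorem parS_lt (p : ℕ) [hp : Fact p.Prime] (m : ℕ) : parS p (m + 1) < p ^ (posA p m + 1) := by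
  have h2 := hp.out.two_le
  have key : ∀ M, parS p M < p ^ posA p M := by
    intro M
    induction M with
    | zero => simpa [parS] using pow_pos hp.out.pos (posA p 0)
    | succ M ih =>
      have h1 : p ^ (posA p M + 1) ≤ p ^ posA p (M + 1) :=
        Nat.pow_le_pow_right hp.out.pos (by rw [posA_succ]; omega)
      have h3 : parS p (M + 1) = parS p M + p ^ posA p M := Finset.sum_range_succ _ _
      have : p ^ posA p M * 2 ≤ p ^ (posA p M + 1) := by
        rw [pow_succ]; exact Nat.mul_le_mul_left _ h2
      omega
  have h3 : parS p (m + 1) = parS p m + p ^ posA p m := Finset.sum_range_succ _ _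
  have : p ^ posA p m * 2 ≤ p ^ (posA p m + 1) := by
    rw [pow_succ]; exact Nat.mul_le_mul_left _ h2
  have := key m
  omega

theorem sum_block (p : ℕ) [hp : Fact p.Prime] (M : ℕ) :
    ∑ n ∈ Finset.range (p * M), (p : ℤ_[p]) ^ (padicValNat p (n !)) = (parS p M : ℤ_[p]) := by
  induction M with
  | zero => simp [parS]
  | succ M ih =>
    have h3 : parS p (M + 1) = parS p M + p ^ posA p M := Finset.sum_range_succ _ _
    rw [mul_add, mul_one, Finset.sum_range_add, ih, h3]
    push_cast
    congr 1
    rw [Finset.sum_congr rfl (g := fun _ => (p : ℤ_[p]) ^ (padicValNat p (M !) + M))]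
    · simp [posA, pow_succ, mul_comm]
    · intro n hn
      rw [padicValNat_factorial_mul_add M (Finset.mem_range.1 hn), padicValNat_factorial_mul]

theorem summable_aux (p : ℕ) [hp : Fact p.Prime] :
    Summable (fun n : ℕ => (p : ℤ_[p]) ^ (padicValNat p (n !))) := by
  apply NonarchimedeanAddGroup.summable_of_tendsto_cofinite_zero
  rw [Nat.cofinite_eq_atTop]
  have h1 : Filter.Tendsto (fun n : ℕ => padicValNat p (n !)) Filter.atTop Filter.atTop := by
    apply Filter.tendsto_atTop_atTop_of_monotone (fun m n h => val_fact_mono p h)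
    intro b
    exact ⟨p * b, by rw [padicValNat_factorial_mul]; omega⟩
  have h2 : Filter.Tendsto (fun n : ℕ => (p : ℤ_[p]) ^ n) Filter.atTop (nhds 0) :=
    tendsto_pow_atTop_nhds_zero_of_norm_lt_one (by
      rw [PadicInt.norm_p]
      exact inv_lt_one_of_one_lt₀ (by exact_mod_cast hp.out.one_lt))
  exact h2.comp h1

theorem alpha_sub_dvd (p : ℕ) [hp : Fact p.Prime] (M : ℕ) :
    (p : ℤ_[p]) ^ posA p M ∣
      (∑' n : ℕ, (p : ℤ_[p]) ^ (padicValNat p (n !))) - (parS p M : ℤ_[p]) := by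
  have key : ∀ M, (p : ℤ_[p]) ^ (padicValNat p (M !) + M) ∣
      (∑' n : ℕ, (p : ℤ_[p]) ^ (padicValNat p (n !))) - (parS p M : ℤ_[p]) := by
    intro M
    rw [← (summable_aux p).sum_add_tsum_nat_add (p * M), sum_block, add_sub_cancel_left,
      ← Ideal.mem_span_singleton, ← PadicInt.norm_le_pow_iff_mem_span_pow]
    refine (IsUltrametricDist.norm_tsum_le _).trans (ciSup_le fun n => ?_)
    rw [PadicInt.norm_le_pow_iff_mem_span_pow, Ideal.mem_span_singleton,
      ← padicValNat_factorial_mul]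
    exact pow_dvd_pow _ (val_fact_mono p (by omega))
  have h := key (M + 1)
  have h3 : parS p (M + 1) = parS p M + p ^ posA p M := Finset.sum_range_succ _ _
  have h4 : (p : ℤ_[p]) ^ posA p M ∣ (p : ℤ_[p]) ^ (padicValNat p ((M + 1)!) + (M + 1)) := by
    apply pow_dvd_pow
    have := posA_succ p M
    have h5 : posA p (M + 1) = padicValNat p ((M + 1)!) + (M + 1) + 1 := rfl
    omega
  have h6 := dvd_add (h4.trans h) (dvd_refl ((p : ℤ_[p]) ^ posA p M))
  rw [h3] at h6
  push_cast at h6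
  convert h6 using 1
  ring

theorem appr_alpha (p : ℕ) [hp : Fact p.Prime] (m n : ℕ) (h1 : posA p m + 1 ≤ n)
    (h2 : n ≤ posA p (m + 1)) :
    PadicInt.appr (∑' n : ℕ, (p : ℤ_[p]) ^ (padicValNat p (n !))) n = parS p (m + 1) := by
  have ha := alpha_sub_dvd p (m + 1)
  generalize (∑' n : ℕ, (p : ℤ_[p]) ^ (padicValNat p (n !))) = x at ha ⊢
  have hs := PadicInt.appr_spec n x
  rw [Ideal.mem_span_singleton] at hs
  have hd := dvd_sub ((pow_dvd_pow _ h2).trans ha) hs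
  have hd2 : (p : ℤ_[p]) ^ n ∣ (((x.appr n : ℤ) - (parS p (m + 1) : ℤ) : ℤ) : ℤ_[p]) := by
    push_cast
    convert hd using 1
    ring
  rw [PadicInt.pow_p_dvd_int_iff] at hd2
  have hm : parS p (m + 1) ≡ x.appr n [MOD p ^ n] := by
    rw [Nat.modEq_iff_dvd]
    exact_mod_cast hd2
  exact (Nat.ModEq.eq_of_lt_of_lt hm
    ((parS_lt p m).trans_le (Nat.pow_le_pow_right hp.out.pos h1)) (PadicInt.appr_lt x n)).symm

theorem padic_series_sum_digits_not_eventually_periodic (p : ℕ) [Fact p.Prime] :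
    ¬ ∃ T : ℕ, 1 ≤ T ∧ ∃ N : ℕ, ∀ i : ℕ, N ≤ i →
      (PadicInt.appr (∑' n : ℕ, (p : ℤ_[p]) ^ (padicValNat p (n !))) (i + T + 1)) / p ^ (i + T) =
      (PadicInt.appr (∑' n : ℕ, (p : ℤ_[p]) ^ (padicValNat p (n !))) (i + 1)) / p ^ i := by
  rintro ⟨T, hT, N, h⟩
  have hp : p.Prime := Fact.out
  obtain ⟨m, hm⟩ : ∃ m, m + 1 = p ^ (N + T) :=
    ⟨p ^ (N + T) - 1, Nat.sub_add_cancel (Nat.one_le_pow _ _ hp.pos)⟩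
  have hlt : N + T < p ^ (N + T) := Nat.lt_pow_self hp.one_lt
  have hA := posA_succ p m
  rw [hm, padicValNat.prime_pow, ← hm] at hA
  have hge : m + 1 ≤ posA p m := by unfold posA; omega
  have hA2 := posA_succ p (m + 1)
  obtain ⟨i, hi⟩ : ∃ i, i + T = posA p (m + 1) := ⟨posA p (m + 1) - T, by omega⟩
  have hh := h i (by omega)
  rw [appr_alpha p m (i + 1) (by omega) (by omega),
    appr_alpha p (m + 1) (i + T + 1) (by omega) (by omega)] at hh
  have hz : parS p (m + 1) / p ^ i = 0 := Nat.div_eq_of_lt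
    ((parS_lt p m).trans_le (Nat.pow_le_pow_right hp.pos (by omega)))
  have h3 : parS p (m + 1 + 1) = parS p (m + 1) + p ^ posA p (m + 1) := Finset.sum_range_succ _ _
  have h1 : 1 ≤ parS p (m + 1 + 1) / p ^ (i + T) := by
    rw [Nat.one_le_div_iff (pow_pos hp.pos _), h3, hi]
    omega
  omega
end

section
/- Let p be a prime, let α_p := ∑' (n : ℕ), (p : ℤ_p)^(v_p(n!)) in ℤ_p, let r ≥ 3, and set v := v_p((p^r)!). Then for every index i with v − r + 2 ≤ i ≤ v − 1, the i-th p-adic digit of α_p is 0: d_i(α_p) = 0. In particular, the p-adic expansion of α_p contains arbitrarily long strings of consecutive zero digits. -/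
open Nat

theorem aux_sum (p : ℕ) [hp : Fact p.Prime] (m : ℕ) :
    ∑ n ∈ Finset.range (p * (m + 1)), p ^ padicValNat p (n !)
      < p ^ (padicValNat p ((p * m)!) + 2) := by
  have h2 := hp.out.two_le
  have blk : ∀ m : ℕ, ∑ j ∈ Finset.range p, p ^ padicValNat p ((p * m + j)!)
      = p ^ (padicValNat p ((p * m)!) + 1) := by
    intro m
    rw [Finset.sum_congr rfl (g := fun _ => p ^ padicValNat p ((p * m)!))]
    · simp [pow_succ, mul_comm]
    · intro j hj
      rw [padicValNat_factorial_mul_add m (Finset.mem_range.mp hj)]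
  induction m with
  | zero =>
    have := blk 0
    simp only [mul_zero, zero_add] at this
    rw [zero_add, mul_one, this, mul_zero]
    exact Nat.pow_lt_pow_right h2 (by lia)
  | succ m ih =>
    rw [mul_add p (m + 1) 1, mul_one, Finset.sum_range_add, blk]
    have hle : padicValNat p ((p * m)!) + 1 ≤ padicValNat p ((p * (m + 1))!) := by
      rw [padicValNat_factorial_mul, padicValNat_factorial_mul]
      have : padicValNat p (m !) ≤ padicValNat p ((m + 1)!) := by
        rw [Nat.factorial_succ, padicValNat.mul (by lia) (Nat.factorial_ne_zero m)]
        lia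
      lia
    have h3 : p ^ (padicValNat p ((p * m)!) + 2) ≤ p ^ (padicValNat p ((p * (m + 1))!) + 1) :=
      Nat.pow_le_pow_right (by lia) (by lia)
    have h4 : 2 * p ^ (padicValNat p ((p * (m + 1))!) + 1)
        ≤ p ^ (padicValNat p ((p * (m + 1))!) + 2) := by
      rw [pow_succ p (padicValNat p ((p * (m + 1))!) + 1), mul_comm 2]
      exact Nat.mul_le_mul_left _ h2
    lia

theorem padic_digits_zero_string (p : ℕ) [Fact p.Prime] (r : ℕ) (hr : 3 ≤ r) :
    ∀ i : ℕ, padicValNat p ((p ^ r)!) - r + 2 ≤ i → i ≤ padicValNat p ((p ^ r)!) - 1 →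
      (PadicInt.appr (∑' n : ℕ, (p : ℤ_[p]) ^ (padicValNat p (n !))) (i + 1)) / p ^ i = 0 := by
  intro i hi1 hi2
  have hp : p.Prime := Fact.out
  have h2 := hp.two_le
  obtain ⟨s, rfl⟩ : ∃ s, r = s + 1 := ⟨r - 1, by lia⟩
  obtain ⟨m, hm⟩ : ∃ m, p ^ s = m + 1 := ⟨p ^ s - 1, by have := Nat.pow_pos (n := s) hp.pos; lia⟩
  have hpr : p ^ (s + 1) = p * (m + 1) := by rw [pow_succ, hm, mul_comm]
  -- valuation of the last block
  have hv : padicValNat p ((p ^ (s + 1))!) = padicValNat p ((p * m)!) + (s + 1) := by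
    have h1 : padicValNat p ((m + 1)!) = s + padicValNat p (m !) := by
      rw [Nat.factorial_succ, padicValNat.mul (by lia) (Nat.factorial_ne_zero m), ← hm,
        padicValNat.prime_pow]
    rw [hpr, padicValNat_factorial_mul, padicValNat_factorial_mul, h1]
    lia
  set S := ∑ n ∈ Finset.range (p ^ (s + 1)), p ^ padicValNat p (n !) with hS
  have hSlt : S < p ^ i := by
    have := aux_sum p m
    rw [← hpr] at this
    exact this.trans_le (Nat.pow_le_pow_right hp.pos (by lia))
  by_cases hsum : Summable (fun n : ℕ => (p : ℤ_[p]) ^ (padicValNat p (n !)))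
  swap
  · rw [tsum_eq_zero_of_not_summable hsum]
    have : PadicInt.appr (0 : ℤ_[p]) (i + 1) = 0 := by
      have h := PadicInt.appr_spec (i + 1) (0 : ℤ_[p])
      have hlt := PadicInt.appr_lt (0 : ℤ_[p]) (i + 1)
      rw [zero_sub, neg_mem_iff, Ideal.mem_span_singleton, ← Nat.cast_pow] at h
      have h' := (PadicInt.pow_p_dvd_int_iff (p := p) (i + 1)
        (PadicInt.appr (0 : ℤ_[p]) (i + 1) : ℤ)).mp (by simpa using h)
      exact Nat.eq_zero_of_dvd_of_lt (by exact_mod_cast h') hlt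
    rw [this, Nat.zero_div]
  rw [← hsum.sum_add_tsum_nat_add (p ^ (s + 1))]
  set T := ∑' n : ℕ, (p : ℤ_[p]) ^ (padicValNat p ((n + p ^ (s + 1))!)) with hT
  have hTm : T ∈ Ideal.span {(p : ℤ_[p]) ^ (i + 1)} := by
    rw [← PadicInt.norm_le_pow_iff_mem_span_pow]
    apply IsUltrametricDist.norm_tsum_le_of_forall_le_of_nonneg (by positivity)
    intro n
    rw [PadicInt.norm_le_pow_iff_mem_span_pow, Ideal.mem_span_singleton]
    apply pow_dvd_pow
    have : padicValNat p ((p ^ (s + 1))!) ≤ padicValNat p ((n + p ^ (s + 1))!) :=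
      (padicValNat_dvd_iff_le (Nat.factorial_ne_zero _)).mp
        (pow_padicValNat_dvd.trans (Nat.factorial_dvd_factorial (by lia)))
    lia
  have hSc : ∑ n ∈ Finset.range (p ^ (s + 1)), (p : ℤ_[p]) ^ padicValNat p (n !) = (S : ℤ_[p]) := by
    rw [hS]; push_cast; rfl
  rw [hSc]
  have h := PadicInt.appr_spec (i + 1) ((S : ℤ_[p]) + T)
  have hlt := PadicInt.appr_lt ((S : ℤ_[p]) + T) (i + 1)
  set a := PadicInt.appr ((S : ℤ_[p]) + T) (i + 1)
  have h5 : ((S : ℤ) - (a : ℤ) : ℤ) = ((S : ℤ_[p]) - (a : ℤ_[p])) := by push_cast; rfl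
  have h6 : ((p : ℤ) ^ (i + 1)) ∣ (S : ℤ) - (a : ℤ) := by
    rw [← PadicInt.pow_p_dvd_int_iff (p := p), h5, ← Ideal.mem_span_singleton]
    have := Ideal.sub_mem _ h hTm
    convert this using 1
    ring
  have hmod : a ≡ S [MOD p ^ (i + 1)] := by
    rw [Nat.modEq_iff_dvd]; exact_mod_cast h6
  have hS2 : S < p ^ (i + 1) := hSlt.trans_le (Nat.pow_le_pow_right hp.pos (by lia))
  rw [Nat.ModEq.eq_of_lt_of_lt hmod hlt hS2]
  exact Nat.div_eq_of_lt hSlt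
end
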